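/- arXiv:1510.03459 — 6 statements merged into one kernel-verified Lean document; each statement's English description precedes it below -/
import Mathlib

section
/- Let 0 < q < 1 and let x ≥ 1, y ≥ 1. Then (x/y)^{y(−((ln q)/(1−q))q^y + ψ_q(y))} · e^{(q^x − q^y)/(1−q)} ≤ Γ_q(x)/Γ_q(y) ≤ (x/y)^{x(−((ln q)/(1−q))q^x + ψ_q(x))} · e^{(q^x − q^y)/(1−q)}. -/
/-- The `q`-extension of the Gamma function: for fixed `q ∈ (0,1)` and `x > 0`,
`Γ_q(x) = (1-q)^{1-x} ∏_{n=0}^∞ (1-q^{n+1})/(1-q^{n+x})`. -/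
noncomputable def qGamma (q x : ℝ) : ℝ :=
  (1 - q) ^ (1 - x) * ∏' n : ℕ, (1 - q ^ (n + 1)) / (1 - q ^ ((n : ℝ) + x))

/-- The `q`-extension of the digamma function:
`ψ_q(x) = -ln(1-q) + (ln q) ∑_{n=1}^∞ q^{n x}/(1-q^n)`. -/
noncomputable def qDigamma (q x : ℝ) : ℝ :=
  -Real.log (1 - q) + Real.log q * ∑' n : ℕ, q ^ (((n : ℝ) + 1) * x) / (1 - q ^ (n + 1))

open Real Set

theorem log_div_mul_le_sub_of_monotoneOn_mul_deriv {f f' : ℝ → ℝ}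
    (hf : ∀ x, 1 ≤ x → HasDerivAt f (f' x) x) (hmono : MonotoneOn (fun x => x * f' x) (Ici 1))
    {x y : ℝ} (hx : 1 ≤ x) (hy : 1 ≤ y) :
    log (x / y) * (y * f' y) ≤ f x - f y := by
  have cauchy : ∀ a b : ℝ, 1 ≤ a → a < b →
      ∃ c ∈ Ioo a b, f b - f a = (log b - log a) * (c * f' c) := by
    intro a b ha hab
    obtain ⟨c, hc, h⟩ := exists_ratio_hasDerivAt_eq_ratio_slope f f' hab
      (fun z hz => (hf z (ha.trans hz.1)).continuousAt.continuousWithinAt)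
      (fun z hz => hf z (ha.trans hz.1.le)) log (fun z => z⁻¹)
      (fun z hz => (continuousAt_log (by linarith [hz.1])).continuousWithinAt)
      (fun z hz => hasDerivAt_log (by linarith [hz.1]))
    have hc0 : 0 < c := by linarith [hc.1]
    refine ⟨c, hc, ?_⟩
    field_simp at h
    linarith
  rw [log_div (by linarith) (by linarith)]
  rcases lt_trichotomy x y with h | rfl | h
  · obtain ⟨c, hc, e⟩ := cauchy x y hx h
    have hm : c * f' c ≤ y * f' y := hmono (hx.trans hc.1.le) hy hc.2.le
    have hl := log_le_log (by linarith) h.le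
    nlinarith [mul_le_mul_of_nonneg_left hm (sub_nonneg.2 hl)]
  · simp
  · obtain ⟨c, hc, e⟩ := cauchy y x hy h
    have hm : y * f' y ≤ c * f' c := hmono hy (hy.trans hc.1.le) hc.1.le
    have hl := log_le_log (by linarith) h.le
    nlinarith [mul_le_mul_of_nonneg_left hm (sub_nonneg.2 hl)]

theorem exp_neg_add_mul_exp_neg_nonneg {t x : ℝ} (ht : 0 < t) (hx : 1 ≤ x) :
    0 ≤ exp (-t) + t * (exp (-t * x) * (t * x - 1)) / (1 - exp (-t)) := by
  have hd : 0 < 1 - exp (-t) := by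
    have := exp_lt_exp.2 (neg_lt_zero.2 ht)
    rw [exp_zero] at this
    linarith
  rcases le_total 1 (t * x) with h | h
  · have : 0 ≤ t * x - 1 := by linarith
    positivity
  · have htx : t ≤ t * x := le_mul_of_one_le_right ht.le hx
    have hexp : exp (-t * x) * (1 - t * x) ≤ exp (-t) * (1 - t) :=
      mul_le_mul (exp_le_exp.2 (by linarith)) (by linarith) (by linarith) (exp_pos _).le
    have key : t * (1 - t) ≤ 1 - exp (-t) := by
      have h1 : exp (-t) * (1 + t) ≤ 1 := by
        have := mul_le_mul_of_nonneg_left (add_one_le_exp t) (exp_pos (-t)).le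
        rw [← exp_add, neg_add_cancel, exp_zero] at this
        linarith
      by_contra! hlt
      nlinarith [mul_lt_mul_of_pos_right hlt (by linarith : 0 < 1 + t), pow_pos ht 3]
    have : exp (-t) + t * (exp (-t * x) * (t * x - 1)) / (1 - exp (-t))
        = (exp (-t) * (1 - exp (-t)) - t * (exp (-t * x) * (1 - t * x))) / (1 - exp (-t)) := by
      field_simp
      ring
    rw [this]
    apply div_nonneg _ hd.le
    have h2 := mul_le_mul_of_nonneg_left hexp ht.le
    have h3 := mul_le_mul_of_nonneg_left key (exp_pos (-t)).le
    linarith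

theorem log_div_mul_le_exp_neg {t x y : ℝ} (ht : 0 < t) (hx : 1 ≤ x) (hy : 1 ≤ y) :
    log (x / y) * (y * (exp (-t) - t * exp (-t * y) / (1 - exp (-t)))) ≤
      (x * exp (-t) + exp (-t * x) / (1 - exp (-t))) -
        (y * exp (-t) + exp (-t * y) / (1 - exp (-t))) := by
  have hexp : ∀ z : ℝ, HasDerivAt (fun z => exp (-t * z)) (exp (-t * z) * -t) z := fun z => by
    simpa using ((hasDerivAt_id z).const_mul (-t)).exp
  have hder : ∀ z : ℝ, HasDerivAt
      (fun z => z * (exp (-t) - t * exp (-t * z) / (1 - exp (-t))))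
      (exp (-t) + t * (exp (-t * z) * (t * z - 1)) / (1 - exp (-t))) z := fun z => by
    refine ((hasDerivAt_id' z).fun_mul
      ((((hexp z).const_mul t).div_const (1 - exp (-t))).const_sub (exp (-t)))).congr_deriv ?_
    ring
  refine log_div_mul_le_sub_of_monotoneOn_mul_deriv
    (f := fun z => z * exp (-t) + exp (-t * z) / (1 - exp (-t)))
    (f' := fun z => exp (-t) - t * exp (-t * z) / (1 - exp (-t))) (fun z _ => ?_) ?_ hx hy
  · refine (((hasDerivAt_id' z).mul_const (exp (-t))).fun_add
      ((hexp z).div_const (1 - exp (-t)))).congr_deriv ?_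
    ring
  · refine monotoneOn_of_hasDerivWithinAt_nonneg (convex_Ici 1)
      (fun z _ => (hder z).continuousAt.continuousWithinAt)
      (fun z _ => (hder z).hasDerivWithinAt) fun z hz => ?_
    rw [interior_Ici] at hz
    exact exp_neg_add_mul_exp_neg_nonneg ht (le_of_lt hz)

theorem log_div_mul_le_rpow {q x y : ℝ} (hq0 : 0 < q) (hq1 : q < 1) (hx : 1 ≤ x) (hy : 1 ≤ y)
    (n : ℕ) :
    log (x / y) * (y * (q ^ (n + 1) / (n + 1) +
        log q * (q ^ (((n : ℝ) + 1) * y) / (1 - q ^ (n + 1))))) ≤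
      (x * (q ^ (n + 1) / (n + 1)) +
          q ^ (((n : ℝ) + 1) * x) / (1 - q ^ (n + 1)) / (n + 1)) -
        (y * (q ^ (n + 1) / (n + 1)) +
          q ^ (((n : ℝ) + 1) * y) / (1 - q ^ (n + 1)) / (n + 1)) := by
  have hn : (0 : ℝ) < n + 1 := by positivity
  have ht : 0 < ((n : ℝ) + 1) * -log q := mul_pos hn (neg_pos.2 (log_neg hq0 hq1))
  have e1 : exp (-(((n : ℝ) + 1) * -log q)) = q ^ (n + 1) := by
    rw [← rpow_natCast, rpow_def_of_pos hq0]
    push_cast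
    ring_nf
  have e2 : ∀ z : ℝ, exp (-(((n : ℝ) + 1) * -log q) * z) = q ^ (((n : ℝ) + 1) * z) := fun z => by
    rw [rpow_def_of_pos hq0]
    ring_nf
  have h := log_div_mul_le_exp_neg ht hx hy
  rw [e1, e2, e2] at h
  have hd : (1 - q ^ (n + 1)) ≠ 0 := by
    have := pow_lt_one₀ hq0.le hq1 n.succ_ne_zero
    exact (sub_pos.2 this).ne'
  refine le_of_eq_of_le ?_ ((div_le_div_of_nonneg_right h hn.le).trans_eq ?_)
  · field_simp
    ring
  · ring

theorem one_sub_le_one_sub_pow_succ {q : ℝ} (hq0 : 0 < q) (hq1 : q < 1) (n : ℕ) : 1 - q ≤ 1 - q ^ (n + 1) :=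
  sub_le_sub_left (pow_le_of_le_one hq0.le hq1.le n.succ_ne_zero) 1

theorem summable_rpow_div_one_sub_pow {q x : ℝ} (hq0 : 0 < q) (hq1 : q < 1) (hx : 0 < x) :
    Summable fun n : ℕ => q ^ (((n : ℝ) + 1) * x) / (1 - q ^ (n + 1)) := by
  have hd : 0 < 1 - q := sub_pos.2 hq1
  have hg : Summable fun n : ℕ => q ^ (((n : ℝ) + 1) * x) / (1 - q) := by
    have hg' := ((summable_nat_add_iff 1).2 (summable_geometric_of_lt_one (rpow_nonneg hq0.le x)
      (rpow_lt_one hq0.le hq1 hx))).div_const (1 - q)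
    refine hg'.congr fun n => ?_
    rw [← rpow_natCast, ← rpow_mul hq0.le]
    push_cast
    ring_nf
  refine hg.of_nonneg_of_le (fun n => ?_) fun n => ?_
  · exact div_nonneg (rpow_nonneg hq0.le _) (hd.le.trans (one_sub_le_one_sub_pow_succ hq0 hq1 n))
  · exact div_le_div_of_nonneg_left (rpow_nonneg hq0.le _) hd (one_sub_le_one_sub_pow_succ hq0 hq1 n)

theorem summable_rpow_div_one_sub_pow_div {q x : ℝ} (hq0 : 0 < q) (hq1 : q < 1) (hx : 0 < x) :
    Summable fun n : ℕ => q ^ (((n : ℝ) + 1) * x) / (1 - q ^ (n + 1)) / (n + 1) := by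
  have h0 : ∀ n : ℕ, 0 ≤ q ^ (((n : ℝ) + 1) * x) / (1 - q ^ (n + 1)) := fun n =>
    div_nonneg (rpow_nonneg hq0.le _) ((sub_pos.2 hq1).le.trans (one_sub_le_one_sub_pow_succ hq0 hq1 n))
  refine (summable_rpow_div_one_sub_pow hq0 hq1 hx).of_nonneg_of_le (fun n => ?_) fun n => ?_
  · exact div_nonneg (h0 n) (by positivity)
  · exact div_le_self (h0 n) (by linarith [n.cast_nonneg (α := ℝ)])

/-- The Lambert-type expansion of `-log ∏ (1 - q^{m+x})`. -/
theorem hasSum_neg_log_one_sub_rpow {q x : ℝ} (hq0 : 0 < q) (hq1 : q < 1) (hx : 0 < x) :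
    HasSum (fun m : ℕ => -log (1 - q ^ ((m : ℝ) + x)))
      (∑' n : ℕ, q ^ (((n : ℝ) + 1) * x) / (1 - q ^ (n + 1)) / (n + 1)) := by
  obtain ⟨F, hF⟩ : ∃ F : ℕ × ℕ → ℝ,
      ∀ p, F p = (q ^ ((p.2 : ℝ) + x)) ^ (p.1 + 1) / ((p.1 : ℝ) + 1) := ⟨_, fun _ => rfl⟩
  have hrow : ∀ n : ℕ, HasSum (fun m => F (n, m))
      (q ^ (((n : ℝ) + 1) * x) / (1 - q ^ (n + 1)) / (n + 1)) := fun n => by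
    have hg := ((hasSum_geometric_of_lt_one (pow_nonneg hq0.le (n + 1))
      (pow_lt_one₀ hq0.le hq1 n.succ_ne_zero)).mul_left
        (q ^ (((n : ℝ) + 1) * x))).div_const ((n : ℝ) + 1)
    rw [← div_eq_mul_inv] at hg
    suffices h : (fun m => F (n, m)) =
        fun m => q ^ (((n : ℝ) + 1) * x) * (q ^ (n + 1)) ^ m / ((n : ℝ) + 1) by
      rw [h]
      exact hg
    funext m
    rw [hF]
    congr 1
    rw [← pow_mul, ← rpow_natCast, ← rpow_natCast q, ← rpow_mul hq0.le, ← rpow_add hq0]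
    push_cast
    ring_nf
  have hcol : ∀ m : ℕ, HasSum (fun n => F (n, m)) (-log (1 - q ^ ((m : ℝ) + x))) := fun m => by
    simp only [hF]
    apply hasSum_pow_div_log_of_abs_lt_one
    rw [abs_of_nonneg (rpow_nonneg hq0.le _)]
    exact rpow_lt_one hq0.le hq1 (by positivity)
  have hsum : Summable F := by
    rw [summable_prod_of_nonneg fun p => by rw [hF]; positivity]
    refine ⟨fun n => (hrow n).summable, ?_⟩
    exact (summable_rpow_div_one_sub_pow_div hq0 hq1 hx).congr fun n => ((hrow n).tsum_eq).symm
  rw [(hsum.hasSum.prod_fiberwise hrow).tsum_eq]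
  exact HasSum.prod_fiberwise (f := F ∘ Prod.swap)
    ((Equiv.prodComm ℕ ℕ).hasSum_iff.2 hsum.hasSum) hcol

theorem qGamma_eq_exp {q x : ℝ} (hq0 : 0 < q) (hq1 : q < 1) (hx : 0 < x) :
    qGamma q x = exp ((1 - x) * log (1 - q) +
      ((∑' n : ℕ, q ^ (((n : ℝ) + 1) * x) / (1 - q ^ (n + 1)) / (n + 1)) -
        ∑' n : ℕ, q ^ (((n : ℝ) + 1) * 1) / (1 - q ^ (n + 1)) / (n + 1))) := by
  have h := ((hasSum_neg_log_one_sub_rpow hq0 hq1 hx).sub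
    (hasSum_neg_log_one_sub_rpow hq0 hq1 one_pos)).rexp
  have hpos : ∀ (z : ℝ) (m : ℕ), 0 < z → 0 < 1 - q ^ ((m : ℝ) + z) := fun z m hz =>
    sub_pos.2 (rpow_lt_one hq0.le hq1 (by positivity))
  have hterm : ∀ m : ℕ, (1 - q ^ (m + 1)) / (1 - q ^ ((m : ℝ) + x)) =
      exp (-log (1 - q ^ ((m : ℝ) + x)) - -log (1 - q ^ ((m : ℝ) + 1))) := fun m => by
    rw [neg_sub_neg, exp_sub, exp_log (hpos x m hx), exp_log (hpos 1 m one_pos)]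
    norm_cast
  rw [qGamma, tprod_congr hterm, exp_add, rpow_def_of_pos (sub_pos.2 hq1), mul_comm (1 - x)]
  congr 1
  exact h.tprod_eq

theorem log_div_mul_le_of_qDigamma {q x y : ℝ} (hq0 : 0 < q) (hq1 : q < 1) (hx : 1 ≤ x)
    (hy : 1 ≤ y) :
    log (x / y) * (y * (-(log q / (1 - q)) * q ^ y + qDigamma q y)) +
        (q ^ x - q ^ y) / (1 - q) ≤
      (y - x) * log (1 - q) +
        ((∑' n : ℕ, q ^ (((n : ℝ) + 1) * x) / (1 - q ^ (n + 1)) / (n + 1)) -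
          ∑' n : ℕ, q ^ (((n : ℝ) + 1) * y) / (1 - q ^ (n + 1)) / (n + 1)) := by
  have hlog : HasSum (fun n : ℕ => q ^ (n + 1) / ((n : ℝ) + 1)) (-log (1 - q)) :=
    hasSum_pow_div_log_of_abs_lt_one (by rwa [abs_of_pos hq0])
  have hF : ∀ z, 1 ≤ z → HasSum (fun n : ℕ => z * (q ^ (n + 1) / ((n : ℝ) + 1)) +
      q ^ (((n : ℝ) + 1) * z) / (1 - q ^ (n + 1)) / (n + 1) -
        if n = 0 then q ^ z / (1 - q) else 0)
      (z * -log (1 - q) + (∑' n : ℕ, q ^ (((n : ℝ) + 1) * z) / (1 - q ^ (n + 1)) / (n + 1)) -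
        q ^ z / (1 - q)) := fun z hz =>
    ((hlog.mul_left z).add (summable_rpow_div_one_sub_pow_div hq0 hq1
      (by linarith : 0 < z)).hasSum).sub (hasSum_ite_eq 0 (q ^ z / (1 - q)))
  have hF' := (((hlog.add ((summable_rpow_div_one_sub_pow hq0 hq1
    (by linarith : 0 < y)).hasSum.mul_left (log q))).sub
      (hasSum_ite_eq 0 (log q * (q ^ y / (1 - q))))).mul_left y).mul_left (log (x / y))
  have hle := hasSum_le (fun n => ?_) hF' ((hF x hx).sub (hF y hy))
  · rw [qDigamma]
    linear_combination hle
  · cases n with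
    | zero =>
      have hy0 : 0 < y := by linarith
      have hl := log_le_sub_one_of_pos (div_pos (by linarith : 0 < x) hy0)
      have h := mul_le_mul_of_nonneg_right hl (mul_pos hy0 hq0).le
      have e : (x / y - 1) * (y * q) = x * q - y * q := by
        field_simp
      rw [e] at h
      simpa using h
    | succ n =>
      simpa using log_div_mul_le_rpow hq0 hq1 hx hy (n + 1)

/-- For `0 < q < 1` and `x ≥ 1`, `y ≥ 1`,
`(x/y)^{y(-((ln q)/(1-q)) q^y + ψ_q(y))} e^{(q^x - q^y)/(1-q)} ≤ Γ_q(x)/Γ_q(y)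
  ≤ (x/y)^{x(-((ln q)/(1-q)) q^x + ψ_q(x))} e^{(q^x - q^y)/(1-q)}`. -/
theorem qGamma_ratio_bounds (q x y : ℝ) (hq0 : 0 < q) (hq1 : q < 1)
    (hx : 1 ≤ x) (hy : 1 ≤ y) :
    (x / y) ^ (y * (-(Real.log q / (1 - q)) * q ^ y + qDigamma q y)) *
        Real.exp ((q ^ x - q ^ y) / (1 - q)) ≤ qGamma q x / qGamma q y ∧
    qGamma q x / qGamma q y ≤
      (x / y) ^ (x * (-(Real.log q / (1 - q)) * q ^ x + qDigamma q x)) *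
        Real.exp ((q ^ x - q ^ y) / (1 - q)) := by
  have hx0 : 0 < x := by linarith
  have hy0 : 0 < y := by linarith
  have hxy := log_div_mul_le_of_qDigamma hq0 hq1 hx hy
  have hyx := log_div_mul_le_of_qDigamma hq0 hq1 hy hx
  rw [← inv_div x y, log_inv] at hyx
  rw [qGamma_eq_exp hq0 hq1 hx0, qGamma_eq_exp hq0 hq1 hy0, ← exp_sub,
    rpow_def_of_pos (div_pos hx0 hy0), rpow_def_of_pos (div_pos hx0 hy0), ← exp_add, ← exp_add,
    exp_le_exp, exp_le_exp]
  constructor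
  · linear_combination hxy
  · linear_combination hyx
end

section
/- Let I ⊆ (0,∞) be an interval and let f : I → (0,∞) be differentiable on I. Then f is geometrically convex on I (i.e., f(√(x₁x₂)) ≤ √(f(x₁)f(x₂)) for all x₁, x₂ ∈ I) if and only if the function x ↦ x·f′(x)/f(x) is nondecreasing on I. -/
/-- A continuous midpoint-convex function on a convex set is convex. -/
theorem ContinuousOn.convexOn_of_midpoint {E : Type*} [AddCommGroup E] [Module ℝ E]
    [TopologicalSpace E] [ContinuousAdd E] [ContinuousSMul ℝ E] {D : Set E} {g : E → ℝ}
    (hg : ContinuousOn g D) (hD : Convex ℝ D)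
    (hmid : ∀ x ∈ D, ∀ y ∈ D, g ((1 / 2 : ℝ) • (x + y)) ≤ (g x + g y) / 2) :
    ConvexOn ℝ D g := by
  refine ⟨hD, fun x hx y hy a b ha hb hab => ?_⟩
  set p : ℝ → E := fun t => (1 - t) • x + t • y with hp
  have hpD : ∀ t ∈ Set.Icc (0 : ℝ) 1, p t ∈ D := fun t ht =>
    hD hx hy (by linarith [ht.2]) ht.1 (by ring)
  set h : ℝ → ℝ := fun t => g (p t) - ((1 - t) * g x + t * g y) with hh
  have hc : ContinuousOn h (Set.Icc 0 1) := by
    have hpc : Continuous p := by fun_prop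
    exact (hg.comp hpc.continuousOn hpD).sub (by fun_prop)
  have h0 : h 0 = 0 := by simp [hh, hp]
  have h1 : h 1 = 0 := by simp [hh, hp]
  have hmidh : ∀ s ∈ Set.Icc (0 : ℝ) 1, ∀ t ∈ Set.Icc (0 : ℝ) 1,
      h ((s + t) / 2) ≤ (h s + h t) / 2 := by
    intro s hs t ht
    have key := hmid _ (hpD s hs) _ (hpD t ht)
    have e : (1 / 2 : ℝ) • (p s + p t) = p ((s + t) / 2) := by
      simp only [hp]
      module
    rw [e] at key
    simp only [hh]
    linarith
  obtain ⟨m, hm, hmax⟩ := isCompact_Icc.exists_isMaxOn (Set.nonempty_Icc.2 zero_le_one) hc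
  have hm0 : h m ≤ 0 := by
    rcases le_total m (1 / 2) with hle | hle
    · have h2 : 2 * m ∈ Set.Icc (0 : ℝ) 1 := ⟨by linarith [hm.1], by linarith⟩
      have key := hmidh 0 (by simp) _ h2
      have hb2 : h (2 * m) ≤ h m := hmax h2
      rw [show (0 + 2 * m) / 2 = m by ring] at key
      linarith
    · have h2 : 2 * m - 1 ∈ Set.Icc (0 : ℝ) 1 := ⟨by linarith, by linarith [hm.2]⟩
      have key := hmidh 1 (by simp) _ h2
      have hb2 : h (2 * m - 1) ≤ h m := hmax h2
      rw [show (1 + (2 * m - 1)) / 2 = m by ring] at key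
      linarith
  have hbm : h b ≤ h m := hmax (show b ∈ Set.Icc (0 : ℝ) 1 from ⟨hb, by linarith⟩)
  obtain rfl : a = 1 - b := by linarith
  simp only [hh, hp] at hbm hm0
  simp only [smul_eq_mul]
  linarith

/-- geometric convexity iff `x ↦ x f'(x)/f(x)` is nondecreasing. -/
theorem geomConvex_iff_monotone (I : Set ℝ) (hI : I ⊆ Set.Ioi 0) (hI' : I.OrdConnected)
    (f f' : ℝ → ℝ) (hpos : ∀ x ∈ I, 0 < f x)
    (hderiv : ∀ x ∈ I, HasDerivAt f (f' x) x) :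
    (∀ x₁ ∈ I, ∀ x₂ ∈ I, f (Real.sqrt (x₁ * x₂)) ≤ Real.sqrt (f x₁ * f x₂)) ↔
      MonotoneOn (fun x => x * f' x / f x) I := by
  set D : Set ℝ := Real.exp ⁻¹' I with hDdef
  set g : ℝ → ℝ := fun t => Real.log (f (Real.exp t)) with hgdef
  have hD : Convex ℝ D := (hI'.preimage_mono Real.exp_monotone).convex
  have hg : ∀ t ∈ D, HasDerivAt g (Real.exp t * f' (Real.exp t) / f (Real.exp t)) t := by
    intro t ht
    have := ((hderiv _ ht).comp t (Real.hasDerivAt_exp t)).log (hpos _ ht).ne'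
    simpa only [mul_comm (f' _), Function.comp_apply] using this
  have hgc : ContinuousOn g D := fun t ht => (hg t ht).continuousAt.continuousWithinAt
  have hlog : ∀ x ∈ I, Real.exp (Real.log x) = x := fun x hx => Real.exp_log (hI hx)
  have hlogD : ∀ x ∈ I, Real.log x ∈ D := fun x hx => by
    simpa only [hDdef, Set.mem_preimage, hlog x hx] using hx
  have hsqrt : ∀ s t : ℝ, √(Real.exp s * Real.exp t) = Real.exp ((1 / 2 : ℝ) * (s + t)) := by
    intro s t
    rw [← Real.exp_add, ← Real.exp_half]
    ring_nf
  have hmidD : ∀ s ∈ D, ∀ t ∈ D, (1 / 2 : ℝ) * (s + t) ∈ D := by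
    intro s hs t ht
    have := hD hs ht (a := 1 / 2) (b := 1 / 2) (by norm_num) (by norm_num) (by norm_num)
    simpa only [smul_eq_mul, mul_add] using this
  have hequiv : ∀ s ∈ D, ∀ t ∈ D,
      (f √(Real.exp s * Real.exp t) ≤ √(f (Real.exp s) * f (Real.exp t)) ↔
        g ((1 / 2 : ℝ) * (s + t)) ≤ (g s + g t) / 2) := by
    intro s hs t ht
    have hs' := hpos _ hs
    have ht' := hpos _ ht
    rw [hsqrt, ← Real.log_le_log_iff (hpos _ (hmidD s hs t ht)) (by positivity),
      Real.log_sqrt (by positivity), Real.log_mul hs'.ne' ht'.ne']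
  have hconv : (∀ x₁ ∈ I, ∀ x₂ ∈ I, f √(x₁ * x₂) ≤ √(f x₁ * f x₂)) ↔ ConvexOn ℝ D g := by
    constructor
    · intro h
      exact hgc.convexOn_of_midpoint hD fun s hs t ht =>
        (hequiv s hs t ht).1 (h _ hs _ ht)
    · intro h x hx y hy
      have key := hequiv _ (hlogD x hx) _ (hlogD y hy)
      rw [hlog x hx, hlog y hy] at key
      refine key.2 ?_
      have hhalf : (0 : ℝ) ≤ 1 / 2 := by norm_num
      have := h.2 (hlogD x hx) (hlogD y hy) hhalf hhalf (by norm_num)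
      simp only [smul_eq_mul, ← mul_add] at this
      linarith
  rw [hconv]
  constructor
  · intro h x hx y hy hxy
    have := h.monotoneOn_deriv (fun t ht => (hg t ht).differentiableAt) (hlogD x hx) (hlogD y hy)
      (Real.log_le_log (hI hx) hxy)
    rw [(hg _ (hlogD x hx)).deriv, (hg _ (hlogD y hy)).deriv, hlog x hx, hlog y hy] at this
    exact this
  · intro h
    refine MonotoneOn.convexOn_of_deriv hD hgc
      (fun t ht => (hg t (interior_subset ht)).differentiableAt.differentiableWithinAt) ?_
    intro s hs t ht hst
    have hsD : s ∈ D := interior_subset hs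
    have htD : t ∈ D := interior_subset ht
    rw [(hg s hsD).deriv, (hg t htD).deriv]
    exact h hsD htD (Real.exp_le_exp.2 hst)
end

section
/- Let I ⊆ (0,∞) be an interval and let f : I → (0,∞) be differentiable on I. Then f is geometrically convex on I (i.e., f(√(x₁x₂)) ≤ √(f(x₁)f(x₂)) for all x₁, x₂ ∈ I) if and only if the inequality f(x)/f(y) ≥ (x/y)^{y·f′(y)/f(y)} holds for all x, y ∈ I. -/
open Filter Topology in
/-- A differentiable function on an order-connected set of reals is midpoint convex iff its graph
lies above each of its tangent lines. -/
theorem midpoint_convex_iff_tangent_le {J : Set ℝ} (hJ : J.OrdConnected) {g g' : ℝ → ℝ}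
    (hg : ∀ t ∈ J, HasDerivAt g (g' t) t) :
    (∀ s ∈ J, ∀ t ∈ J, g ((s + t) / 2) ≤ (g s + g t) / 2) ↔
      ∀ s ∈ J, ∀ t ∈ J, g' t * (s - t) ≤ g s - g t := by
  have hmid : ∀ s ∈ J, ∀ t ∈ J, (s + t) / 2 ∈ J := by
    intro s hs t ht
    rcases le_total s t with h | h
    · exact hJ.out hs ht ⟨by linarith, by linarith⟩
    · exact hJ.out ht hs ⟨by linarith, by linarith⟩
  constructor
  · intro h s hs t ht
    have key : ∀ n : ℕ, t + (1 / 2 : ℝ) ^ n * (s - t) ∈ J ∧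
        g (t + (1 / 2 : ℝ) ^ n * (s - t)) - g t ≤ (1 / 2 : ℝ) ^ n * (g s - g t) := by
      intro n
      induction n with
      | zero => simpa using hs
      | succ n ih =>
        have e : t + (1 / 2 : ℝ) ^ (n + 1) * (s - t)
            = ((t + (1 / 2 : ℝ) ^ n * (s - t)) + t) / 2 := by ring
        rw [e]
        refine ⟨hmid _ ih.1 _ ht, ?_⟩
        have h₁ := h _ ih.1 _ ht
        have h₂ := ih.2
        rw [pow_succ]
        linarith
    have hd : HasDerivAt (fun u : ℝ => g (t + u * (s - t))) (g' t * (s - t)) 0 := by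
      have h₁ : HasDerivAt (fun u : ℝ => t + u * (s - t)) (s - t) 0 := by
        simpa using ((hasDerivAt_id (0 : ℝ)).mul_const (s - t)).const_add t
      exact HasDerivAt.comp (0 : ℝ) (by simpa using hg t ht) h₁
    have hlim : Tendsto (fun n : ℕ => (1 / 2 : ℝ) ^ n) atTop (𝓝[>] 0) :=
      tendsto_nhdsWithin_iff.2 ⟨tendsto_pow_atTop_nhds_zero_of_lt_one (by norm_num) (by norm_num),
        Eventually.of_forall fun n => by simp⟩
    refine le_of_tendsto (hd.tendsto_slope_zero_right.comp hlim)
      (Eventually.of_forall fun n => ?_)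
    have hp : (0 : ℝ) < (1 / 2) ^ n := by positivity
    simp only [Function.comp_apply, zero_add, zero_mul, add_zero, smul_eq_mul]
    rw [inv_mul_le_iff₀ hp]
    exact (key n).2
  · intro h s hs t ht
    have h₁ := h s hs _ (hmid s hs t ht)
    have h₂ := h t ht _ (hmid s hs t ht)
    linarith

/-- geometric convexity iff `f(x)/f(y) ≥ (x/y)^{y f'(y)/f(y)}` for all `x, y ∈ I`. -/
theorem geomConvex_iff_ratio_bound (I : Set ℝ) (hI : I ⊆ Set.Ioi 0) (hI' : I.OrdConnected)
    (f f' : ℝ → ℝ) (hpos : ∀ x ∈ I, 0 < f x)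
    (hderiv : ∀ x ∈ I, HasDerivAt f (f' x) x) :
    (∀ x₁ ∈ I, ∀ x₂ ∈ I, f (Real.sqrt (x₁ * x₂)) ≤ Real.sqrt (f x₁ * f x₂)) ↔
      ∀ x ∈ I, ∀ y ∈ I, (x / y) ^ (y * f' y / f y) ≤ f x / f y := by
  have hJ : (Real.exp ⁻¹' I).OrdConnected := hI'.preimage_mono Real.exp_monotone
  have hg : ∀ t ∈ Real.exp ⁻¹' I, HasDerivAt (fun t => Real.log (f (Real.exp t)))
      (Real.exp t * f' (Real.exp t) / f (Real.exp t)) t := by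
    intro t ht
    have h := ((hderiv _ ht).comp t (Real.hasDerivAt_exp t)).log (hpos _ ht).ne'
    rwa [mul_comm (f' _)] at h
  have hexp : ∀ p : ℝ → Prop, (∀ x ∈ I, p x) ↔ ∀ t ∈ Real.exp ⁻¹' I, p (Real.exp t) := by
    refine fun p => ⟨fun h t ht => h _ ht, fun h x hx => ?_⟩
    have e := Real.exp_log (hI hx)
    have := h (Real.log x) (by rwa [Set.mem_preimage, e])
    rwa [e] at this
  have hsqrt : ∀ s t : ℝ, Real.sqrt (Real.exp s * Real.exp t) = Real.exp ((s + t) / 2) := by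
    intro s t
    rw [← Real.exp_add, Real.exp_half]
  rw [hexp]
  simp_rw [hexp fun x₂ => f (Real.sqrt (_ * x₂)) ≤ Real.sqrt (f _ * f x₂)]
  rw [hexp fun x => ∀ y ∈ I, (x / y) ^ (y * f' y / f y) ≤ f x / f y]
  simp_rw [hexp fun y => (_ / y) ^ (y * f' y / f y) ≤ f _ / f y]
  refine Iff.trans ?_ ((midpoint_convex_iff_tangent_le hJ hg).trans ?_)
  · refine forall₄_congr fun s hs t ht => ?_
    have hm : Real.exp ((s + t) / 2) ∈ I := by
      rcases le_total s t with h | h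
      · exact hJ.out hs ht ⟨by linarith, by linarith⟩
      · exact hJ.out ht hs ⟨by linarith, by linarith⟩
    have h₁ := hpos _ hs
    have h₂ := hpos _ ht
    rw [hsqrt, ← Real.log_le_log_iff (hpos _ hm) (Real.sqrt_pos.2 (mul_pos h₁ h₂)),
      Real.log_sqrt (mul_pos h₁ h₂).le, Real.log_mul h₁.ne' h₂.ne']
  · refine forall₄_congr fun s hs t ht => ?_
    have h₁ := hpos _ hs
    have h₂ := hpos _ ht
    rw [← Real.exp_sub, ← Real.exp_mul, ← Real.le_log_iff_exp_le (div_pos h₁ h₂),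
      Real.log_div h₁.ne' h₂.ne', mul_comm (s - t)]
end

section
/- Let 0 < q < 1. Then the function x ↦ x·(−((ln q)/(1−q))q^x + ψ_q(x)) is nondecreasing on [1, ∞). -/
/-- The terms of the series for `ψ_q` decrease in `x`. -/
lemma qDigamma_term_anti {q : ℝ} (hq0 : 0 < q) (hq1 : q < 1) (n : ℕ) {x y : ℝ} (hxy : x ≤ y) :
    q ^ (((n : ℝ) + 1) * y) / (1 - q ^ (n + 1)) ≤ q ^ (((n : ℝ) + 1) * x) / (1 - q ^ (n + 1)) := by
  have h1 : q ^ (n + 1) < 1 := pow_lt_one₀ hq0.le hq1 (by omega)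
  apply div_le_div_of_nonneg_right _ (by linarith)
  apply Real.rpow_le_rpow_of_exponent_ge hq0 hq1.le
  gcongr

lemma qDigamma_term_nonneg {q : ℝ} (hq0 : 0 < q) (hq1 : q < 1) (n : ℕ) (x : ℝ) :
    0 ≤ q ^ (((n : ℝ) + 1) * x) / (1 - q ^ (n + 1)) := by
  have h1 : q ^ (n + 1) < 1 := pow_lt_one₀ hq0.le hq1 (by omega)
  have := Real.rpow_nonneg hq0.le (((n : ℝ) + 1) * x)
  exact div_nonneg this (by linarith)

lemma summable_qDigamma_term {q : ℝ} (hq0 : 0 < q) (hq1 : q < 1) {x : ℝ} (hx : 0 < x) :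
    Summable fun n : ℕ => q ^ (((n : ℝ) + 1) * x) / (1 - q ^ (n + 1)) := by
  have hr1 : q ^ x < 1 := Real.rpow_lt_one hq0.le hq1 hx
  have hr0 : 0 ≤ q ^ x := Real.rpow_nonneg hq0.le x
  have hgeom := ((summable_nat_add_iff 1).2 (summable_geometric_of_lt_one hr0 hr1)).div_const (1 - q)
  refine Summable.of_nonneg_of_le (fun n => qDigamma_term_nonneg hq0 hq1 n x) (fun n => ?_) hgeom
  have h1 : q ^ (n + 1) ≤ q := pow_le_of_le_one hq0.le hq1.le (by omega)
  have h2 : q ^ (((n : ℝ) + 1) * x) = (q ^ x) ^ (n + 1) := by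
    rw [mul_comm, Real.rpow_mul hq0.le, ← Real.rpow_natCast]
    push_cast
    rfl
  rw [h2]
  have h3 : 0 < 1 - q := by linarith
  gcongr

/-- Comparison of a term of the series for `ψ_q(1)` with a telescoping difference. -/
lemma neg_log_mul_pow_div_le {q : ℝ} (hq0 : 0 < q) (hq1 : q < 1) (n : ℕ) :
    -Real.log q * (q ^ (n + 2) / (1 - q ^ (n + 2))) ≤
      Real.log (1 - q ^ (n + 2)) - Real.log (1 - q ^ (n + 1)) := by
  have h1 : 0 < 1 - q ^ (n + 1) := sub_pos.2 (pow_lt_one₀ hq0.le hq1 (by omega))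
  have h2 : 0 < 1 - q ^ (n + 2) := sub_pos.2 (pow_lt_one₀ hq0.le hq1 (by omega))
  have hlog : -Real.log q ≤ q⁻¹ - 1 := by
    have := Real.one_sub_inv_le_log_of_pos hq0
    linarith
  have hquot := Real.one_sub_inv_le_log_of_pos (div_pos h2 h1)
  rw [Real.log_div h2.ne' h1.ne'] at hquot
  have hpos : 0 ≤ q ^ (n + 2) / (1 - q ^ (n + 2)) := by positivity
  calc _ ≤ (q⁻¹ - 1) * (q ^ (n + 2) / (1 - q ^ (n + 2))) := by gcongr
    _ = 1 - ((1 - q ^ (n + 2)) / (1 - q ^ (n + 1)))⁻¹ := by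
      rw [inv_div]
      field_simp
      ring
    _ ≤ _ := hquot

/-- Removing the first term of the series for `ψ_q(1)` leaves `ψ_q(2) ≥ 0`. -/
lemma neg_log_mul_tsum_le {q : ℝ} (hq0 : 0 < q) (hq1 : q < 1) :
    -Real.log q * ∑' n : ℕ, q ^ (n + 2) / (1 - q ^ (n + 2)) ≤ -Real.log (1 - q) := by
  have hL : 0 ≤ -Real.log q := by linarith [Real.log_neg hq0 hq1]
  rw [← tsum_mul_left]
  have hpow (n : ℕ) : q ^ (n + 1) < 1 := pow_lt_one₀ hq0.le hq1 (by omega)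
  refine Real.tsum_le_of_sum_range_le (fun n => ?_) (fun N => ?_)
  · have := sub_pos.2 (hpow (n + 1))
    positivity
  · calc _ ≤ ∑ n ∈ Finset.range N,
          (Real.log (1 - q ^ (n + 2)) - Real.log (1 - q ^ (n + 1))) :=
        Finset.sum_le_sum fun n _ => neg_log_mul_pow_div_le hq0 hq1 n
      _ = Real.log (1 - q ^ (N + 1)) - Real.log (1 - q) := by
        simpa using Finset.sum_range_sub (fun n => Real.log (1 - q ^ (n + 1))) N
      _ ≤ _ := by
        have : Real.log (1 - q ^ (N + 1)) ≤ 0 :=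
          Real.log_nonpos (sub_pos.2 (hpow N)).le (by linarith [pow_pos hq0 (N + 1)])
        linarith

lemma qDigamma_sub_first_term {q : ℝ} (hq0 : 0 < q) (hq1 : q < 1) {x : ℝ} (hx : 0 < x) :
    -(Real.log q / (1 - q)) * q ^ x + qDigamma q x =
      -Real.log (1 - q) +
        Real.log q * ∑' n : ℕ, q ^ (((n + 1 : ℕ) + 1 : ℝ) * x) / (1 - q ^ (n + 1 + 1)) := by
  rw [qDigamma, (summable_qDigamma_term hq0 hq1 hx).tsum_eq_zero_add]
  simp only [Nat.cast_zero, zero_add, one_mul, pow_one]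
  ring

theorem monotoneOn_aux_qDigamma (q : ℝ) (hq0 : 0 < q) (hq1 : q < 1) :
    MonotoneOn (fun x => x * (-(Real.log q / (1 - q)) * q ^ x + qDigamma q x))
      (Set.Ici (1 : ℝ)) := by
  have hL : Real.log q ≤ 0 := (Real.log_neg hq0 hq1).le
  have hmono : MonotoneOn (fun x => -(Real.log q / (1 - q)) * q ^ x + qDigamma q x)
      (Set.Ici (1 : ℝ)) := by
    intro x hx y hy hxy
    have hx0 : (0 : ℝ) < x := zero_lt_one.trans_le hx
    have hy0 : (0 : ℝ) < y := zero_lt_one.trans_le hy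
    simp only [qDigamma_sub_first_term hq0 hq1 hx0, qDigamma_sub_first_term hq0 hq1 hy0]
    refine add_le_add_right (mul_le_mul_of_nonpos_left ?_ hL) _
    exact ((summable_nat_add_iff 1).2 (summable_qDigamma_term hq0 hq1 hy0)).tsum_le_tsum
      (fun n => qDigamma_term_anti hq0 hq1 (n + 1) hxy)
      ((summable_nat_add_iff 1).2 (summable_qDigamma_term hq0 hq1 hx0))
  have hone : 0 ≤ -(Real.log q / (1 - q)) * q ^ (1 : ℝ) + qDigamma q 1 := by
    rw [qDigamma_sub_first_term hq0 hq1 one_pos]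
    have hterm (n : ℕ) : q ^ (((n + 1 : ℕ) + 1 : ℝ) * 1) = q ^ (n + 2) := by
      rw [← Real.rpow_natCast]
      push_cast
      ring_nf
    simp only [hterm]
    linarith [neg_log_mul_tsum_le hq0 hq1]
  intro x hx y hy hxy
  exact mul_le_mul hxy (hmono hx hy hxy) (hone.trans (hmono Set.self_mem_Ici hx hx))
    (zero_le_one.trans hy)
end

section
/- Let 0 < q < 1 and x > 0. Then the function t ↦ ln Γ_q(t) is differentiable at x with derivative ψ_q(x); that is, d/dx ln Γ_q(x) = −ln(1−q) + (ln q) ∑_{n=1}^∞ q^{nx}/(1−q^n). -/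
open Real in
/-- Logarithm of one factor `(1 - q ^ (n + 1)) / (1 - q ^ (n + t))` of the product for `Γ_q`
has derivative `log q * (q ^ (n + t) / (1 - q ^ (n + t)))`. -/
theorem hasDerivAt_log_qGamma_factor {q t : ℝ} (hq0 : 0 < q) (hq1 : q < 1) (ht : 0 < t) (n : ℕ) :
    HasDerivAt (fun t => log ((1 - q ^ (n + 1)) / (1 - q ^ ((n : ℝ) + t))))
      (log q * (q ^ ((n : ℝ) + t) / (1 - q ^ ((n : ℝ) + t)))) t := by
  have hden : 0 < 1 - q ^ ((n : ℝ) + t) := sub_pos.2 (rpow_lt_one hq0.le hq1 (by positivity))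
  have hnum : 0 < 1 - q ^ (n + 1) := sub_pos.2 (pow_lt_one₀ hq0.le hq1 n.succ_ne_zero)
  have hpow : HasDerivAt (fun t => 1 - q ^ ((n : ℝ) + t))
      (-(log q * 1 * q ^ ((n : ℝ) + t))) t :=
    (((hasDerivAt_id t).const_add (n : ℝ)).const_rpow hq0).const_sub 1
  have hlog := (hpow.log hden.ne').const_sub (log (1 - q ^ (n + 1)))
  have hd : -(-(log q * 1 * q ^ ((n : ℝ) + t)) / (1 - q ^ ((n : ℝ) + t))) =
      log q * (q ^ ((n : ℝ) + t) / (1 - q ^ ((n : ℝ) + t))) := by ring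
  rw [hd] at hlog
  refine hlog.congr_of_eventuallyEq ?_
  filter_upwards [lt_mem_nhds ht] with s hs
  exact log_div hnum.ne' (sub_pos.2 (rpow_lt_one hq0.le hq1 (by positivity))).ne'

open Real in
theorem summable_rpow_natCast_add {q : ℝ} (hq0 : 0 < q) (hq1 : q < 1) (t : ℝ) :
    Summable fun n : ℕ => q ^ ((n : ℝ) + t) := by
  simp only [rpow_add hq0, rpow_natCast]
  exact (summable_geometric_of_lt_one hq0.le hq1).mul_right _

open Real in
theorem summable_log_one_sub_rpow {q : ℝ} (hq0 : 0 < q) (hq1 : q < 1) (t : ℝ) :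
    Summable fun n : ℕ => log (1 - q ^ ((n : ℝ) + t)) := by
  simpa only [sub_eq_add_neg] using
    summable_log_one_add_of_summable (summable_rpow_natCast_add hq0 hq1 t).neg

open Real in
theorem summable_log_qGamma_factor {q t : ℝ} (hq0 : 0 < q) (hq1 : q < 1) (ht : 0 < t) :
    Summable fun n : ℕ => log ((1 - q ^ (n + 1)) / (1 - q ^ ((n : ℝ) + t))) := by
  refine ((summable_log_one_sub_rpow hq0 hq1 1).sub
    (summable_log_one_sub_rpow hq0 hq1 t)).congr fun n => ?_
  rw [log_div (sub_pos.2 (pow_lt_one₀ hq0.le hq1 n.succ_ne_zero)).ne'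
    (sub_pos.2 (rpow_lt_one hq0.le hq1 (by positivity))).ne', ← rpow_natCast q (n + 1)]
  push_cast
  rfl

open Real in
theorem log_qGamma_eq {q t : ℝ} (hq0 : 0 < q) (hq1 : q < 1) (ht : 0 < t) :
    log (qGamma q t) = (1 - t) * log (1 - q) +
      ∑' n : ℕ, log ((1 - q ^ (n + 1)) / (1 - q ^ ((n : ℝ) + t))) := by
  have hfactor (n : ℕ) : 0 < (1 - q ^ (n + 1)) / (1 - q ^ ((n : ℝ) + t)) :=
    div_pos (sub_pos.2 (pow_lt_one₀ hq0.le hq1 n.succ_ne_zero))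
      (sub_pos.2 (rpow_lt_one hq0.le hq1 (by positivity)))
  have hq : 0 < 1 - q := sub_pos.2 hq1
  rw [qGamma, ← rexp_tsum_eq_tprod hfactor (summable_log_qGamma_factor hq0 hq1 ht),
    log_mul (rpow_pos_of_pos hq _).ne' (exp_pos _).ne', log_rpow hq, log_exp]

open Real in
/-- The Lambert series rearrangement: expand each term as a geometric series and swap the sums. -/
theorem tsum_rpow_div_one_sub_rpow {q x : ℝ} (hq0 : 0 < q) (hq1 : q < 1) (hx : 0 < x) :
    ∑' n : ℕ, q ^ ((n : ℝ) + x) / (1 - q ^ ((n : ℝ) + x)) =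
      ∑' n : ℕ, q ^ (((n : ℝ) + 1) * x) / (1 - q ^ (n + 1)) := by
  have hlt (n : ℕ) : q ^ ((n : ℝ) + x) < 1 := rpow_lt_one hq0.le hq1 (by positivity)
  have hrow (n : ℕ) : HasSum (fun m : ℕ => (q ^ ((n : ℝ) + x)) ^ (m + 1))
      (q ^ ((n : ℝ) + x) / (1 - q ^ ((n : ℝ) + x))) := by
    simpa only [pow_succ', div_eq_mul_inv] using
      (hasSum_geometric_of_lt_one (rpow_nonneg hq0.le _) (hlt n)).mul_left (q ^ ((n : ℝ) + x))
  have hcol (m : ℕ) : HasSum (fun n : ℕ => (q ^ ((n : ℝ) + x)) ^ (m + 1))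
      (q ^ (((m : ℝ) + 1) * x) / (1 - q ^ (m + 1))) := by
    have hterm (n : ℕ) : (q ^ ((n : ℝ) + x)) ^ (m + 1) =
        q ^ (((m : ℝ) + 1) * x) * (q ^ (m + 1)) ^ n := by
      rw [← pow_mul, ← rpow_natCast, ← rpow_natCast, ← rpow_mul hq0.le, ← rpow_add hq0]
      push_cast
      ring_nf
    simpa only [hterm, div_eq_mul_inv] using
      (hasSum_geometric_of_lt_one (pow_nonneg hq0.le _)
        (pow_lt_one₀ hq0.le hq1 m.succ_ne_zero)).mul_left (q ^ (((m : ℝ) + 1) * x))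
  have hsum : Summable (Function.uncurry fun n m : ℕ => (q ^ ((n : ℝ) + x)) ^ (m + 1)) := by
    refine (summable_prod_of_nonneg fun p => by
      simp only [Function.uncurry, Pi.zero_apply]; positivity).2
      ⟨fun n => (hrow n).summable, ?_⟩
    simp only [Function.uncurry, (hrow _).tsum_eq]
    refine .of_nonneg_of_le
      (fun n => div_nonneg (rpow_nonneg hq0.le _) (sub_pos.2 (hlt n)).le) (fun n => ?_)
      ((summable_rpow_natCast_add hq0 hq1 x).div_const (1 - q ^ x))
    have hxlt : 0 < 1 - q ^ x := sub_pos.2 (rpow_lt_one hq0.le hq1 hx)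
    have hle : q ^ ((n : ℝ) + x) ≤ q ^ x :=
      rpow_le_rpow_of_exponent_ge hq0 hq1.le (by linarith [n.cast_nonneg (α := ℝ)])
    gcongr
  simpa only [(hrow _).tsum_eq, (hcol _).tsum_eq] using hsum.tsum_comm.symm

open Real in
theorem hasDerivAt_tsum_log_qGamma_factor {q x : ℝ} (hq0 : 0 < q) (hq1 : q < 1) (hx : 0 < x) :
    HasDerivAt (fun t => ∑' n : ℕ, log ((1 - q ^ (n + 1)) / (1 - q ^ ((n : ℝ) + t))))
      (∑' n : ℕ, log q * (q ^ ((n : ℝ) + x) / (1 - q ^ ((n : ℝ) + x)))) x := by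
  have hx2 : x / 2 < x := half_lt_self hx
  have hden : 0 < 1 - q ^ (x / 2) := sub_pos.2 (rpow_lt_one hq0.le hq1 (half_pos hx))
  refine hasDerivAt_tsum_of_isPreconnected
    (((summable_rpow_natCast_add hq0 hq1 (x / 2)).div_const (1 - q ^ (x / 2))).mul_left |log q|)
    isOpen_Ioi isPreconnected_Ioi
    (fun n t ht => hasDerivAt_log_qGamma_factor hq0 hq1 ((half_pos hx).trans ht) n)
    (fun n t ht => ?_) (Set.mem_Ioi.2 hx2) (summable_log_qGamma_factor hq0 hq1 hx)
    (Set.mem_Ioi.2 hx2)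
  have ht' : x / 2 < t := ht
  have hn : (0 : ℝ) ≤ n := n.cast_nonneg
  have hle : q ^ ((n : ℝ) + t) ≤ q ^ ((n : ℝ) + x / 2) :=
    rpow_le_rpow_of_exponent_ge hq0 hq1.le (by linarith)
  have hle' : q ^ ((n : ℝ) + t) ≤ q ^ (x / 2) :=
    rpow_le_rpow_of_exponent_ge hq0 hq1.le (by linarith)
  rw [norm_mul, norm_eq_abs, norm_of_nonneg
    (div_nonneg (rpow_nonneg hq0.le _) (by linarith))]
  gcongr

/-- `d/dx ln Γ_q(x) = ψ_q(x) = -ln(1-q) + (ln q) ∑_{n=1}^∞ q^{nx}/(1-q^n)`. -/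
theorem hasDerivAt_log_qGamma (q x : ℝ) (hq0 : 0 < q) (hq1 : q < 1) (hx : 0 < x) :
    HasDerivAt (fun t => Real.log (qGamma q t))
      (-Real.log (1 - q) +
        Real.log q * ∑' n : ℕ, q ^ (((n : ℝ) + 1) * x) / (1 - q ^ (n + 1))) x := by
  have hlin : HasDerivAt (fun t : ℝ => (1 - t) * Real.log (1 - q)) (-Real.log (1 - q)) x := by
    simpa using ((hasDerivAt_id x).const_sub 1).mul_const (Real.log (1 - q))
  have hmain := hlin.add (hasDerivAt_tsum_log_qGamma_factor hq0 hq1 hx)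
  rw [tsum_mul_left, tsum_rpow_div_one_sub_rpow hq0 hq1 hx] at hmain
  refine hmain.congr_of_eventuallyEq ?_
  filter_upwards [lt_mem_nhds hx] with t ht
  exact log_qGamma_eq hq0 hq1 ht
end

section
/- Let 0 < q < 1. Then the q-digamma function ψ_q has a uniquely determined positive root: there exists a unique x > 0 such that ψ_q(x) = 0. -/
/-- The power series in `t = q ^ x` underlying the `q`-digamma function. -/
noncomputable def qDigammaSeries (q t : ℝ) : ℝ :=
  ∑' n : ℕ, t ^ (n + 1) / (1 - q ^ (n + 1))

lemma one_sub_pow_succ_pos {q : ℝ} (hq0 : 0 < q) (hq1 : q < 1) (n : ℕ) :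
    0 < 1 - q ^ (n + 1) :=
  sub_pos.2 (pow_lt_one₀ hq0.le hq1 n.succ_ne_zero)

lemma pow_succ_div_one_sub_le {q r : ℝ} (hq0 : 0 < q) (hq1 : q < 1) (hr : 0 ≤ r) (n : ℕ) :
    r ^ (n + 1) / (1 - q ^ (n + 1)) ≤ r ^ (n + 1) / (1 - q) := by
  have h : q ^ (n + 1) ≤ q := pow_le_of_le_one hq0.le hq1.le n.succ_ne_zero
  have h1 : 0 < 1 - q := sub_pos.2 hq1
  gcongr

lemma summable_pow_succ {r : ℝ} (hr0 : 0 ≤ r) (hr1 : r < 1) :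
    Summable fun n : ℕ => r ^ (n + 1) :=
  (summable_nat_add_iff 1).2 (summable_geometric_of_lt_one hr0 hr1)

lemma summable_qDigammaSeries {q r : ℝ} (hq0 : 0 < q) (hq1 : q < 1) (hr0 : 0 ≤ r)
    (hr1 : r < 1) : Summable fun n : ℕ => r ^ (n + 1) / (1 - q ^ (n + 1)) :=
  Summable.of_nonneg_of_le
    (fun n => div_nonneg (pow_nonneg hr0 _) (one_sub_pow_succ_pos hq0 hq1 n).le)
    (fun n => pow_succ_div_one_sub_le hq0 hq1 hr0 n)
    ((summable_pow_succ hr0 hr1).div_const _)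

lemma strictMonoOn_qDigammaSeries {q : ℝ} (hq0 : 0 < q) (hq1 : q < 1) :
    StrictMonoOn (qDigammaSeries q) (Set.Ico 0 1) := by
  intro s hs t ht hst
  have hlt (n : ℕ) : s ^ (n + 1) / (1 - q ^ (n + 1)) < t ^ (n + 1) / (1 - q ^ (n + 1)) :=
    div_lt_div_of_pos_right (pow_lt_pow_left₀ hst hs.1 n.succ_ne_zero)
      (one_sub_pow_succ_pos hq0 hq1 n)
  exact Summable.tsum_lt_tsum (i := 0) (fun n => (hlt n).le) (hlt 0)
    (summable_qDigammaSeries hq0 hq1 hs.1 hs.2) (summable_qDigammaSeries hq0 hq1 ht.1 ht.2)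

lemma continuousOn_qDigammaSeries {q r : ℝ} (hq0 : 0 < q) (hq1 : q < 1) (hr0 : 0 ≤ r)
    (hr1 : r < 1) : ContinuousOn (qDigammaSeries q) (Set.Icc 0 r) := by
  refine continuousOn_tsum (fun n => by fun_prop) (summable_qDigammaSeries hq0 hq1 hr0 hr1) ?_
  intro n t ht
  have h := one_sub_pow_succ_pos hq0 hq1 n
  rw [Real.norm_of_nonneg (div_nonneg (pow_nonneg ht.1 _) h.le)]
  exact div_le_div_of_nonneg_right (pow_le_pow_left₀ ht.1 ht.2 _) h.le

lemma div_one_sub_le_qDigammaSeries {q r : ℝ} (hq0 : 0 < q) (hq1 : q < 1) (hr0 : 0 ≤ r)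
    (hr1 : r < 1) : r / (1 - r) ≤ qDigammaSeries q r := by
  have hg : ∑' n : ℕ, r ^ (n + 1) = r / (1 - r) := by
    simp_rw [pow_succ']
    rw [tsum_mul_left, tsum_geometric_of_lt_one hr0 hr1, div_eq_mul_inv]
  rw [← hg]
  refine Summable.tsum_le_tsum (fun n => ?_) (summable_pow_succ hr0 hr1)
    (summable_qDigammaSeries hq0 hq1 hr0 hr1)
  rw [le_div_iff₀ (one_sub_pow_succ_pos hq0 hq1 n)]
  have h1 : 0 ≤ r ^ (n + 1) := pow_nonneg hr0 _
  have h2 : 0 < q ^ (n + 1) := pow_pos hq0 _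
  nlinarith [mul_nonneg h1 h2.le]

lemma exists_qDigammaSeries_eq {q c : ℝ} (hq0 : 0 < q) (hq1 : q < 1) (hc : 0 < c) :
    ∃ t, 0 < t ∧ t < 1 ∧ qDigammaSeries q t = c := by
  have hr0 : 0 ≤ c / (1 + c) := by positivity
  have hr1 : c / (1 + c) < 1 := by rw [div_lt_one (by positivity)]; linarith
  have hz : qDigammaSeries q 0 = 0 := by simp [qDigammaSeries]
  have hle : c ≤ qDigammaSeries q (c / (1 + c)) := by
    convert div_one_sub_le_qDigammaSeries hq0 hq1 hr0 hr1 using 1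
    field_simp
    ring
  obtain ⟨t, ht, htc⟩ := intermediate_value_Icc hr0 (continuousOn_qDigammaSeries hq0 hq1 hr0 hr1)
    (show c ∈ Set.Icc _ _ from ⟨hz.trans_le hc.le, hle⟩)
  refine ⟨t, ht.1.lt_of_ne ?_, ht.2.trans_lt hr1, htc⟩
  rintro rfl
  exact hc.ne (hz.symm.trans htc)

lemma qDigamma_eq_zero_iff {q : ℝ} (hq0 : 0 < q) (hq1 : q < 1) (x : ℝ) :
    qDigamma q x = 0 ↔ qDigammaSeries q (q ^ x) = Real.log (1 - q) / Real.log q := by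
  have hS : qDigamma q x = -Real.log (1 - q) + Real.log q * qDigammaSeries q (q ^ x) := by
    unfold qDigamma qDigammaSeries
    congr! 5 with n
    rw [mul_comm, Real.rpow_mul hq0.le, ← Nat.cast_succ, Real.rpow_natCast]
  rw [hS, eq_div_iff (Real.log_neg hq0 hq1).ne, mul_comm, neg_add_eq_zero, eq_comm]

/-- `ψ_q` has a unique positive root. -/
theorem qDigamma_exists_unique_root (q : ℝ) (hq0 : 0 < q) (hq1 : q < 1) :
    ∃! x : ℝ, 0 < x ∧ qDigamma q x = 0 := by
  have hc : 0 < Real.log (1 - q) / Real.log q :=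
    div_pos_of_neg_of_neg (Real.log_neg (by linarith) (by linarith)) (Real.log_neg hq0 hq1)
  obtain ⟨t, ht0, ht1, ht⟩ := exists_qDigammaSeries_eq hq0 hq1 hc
  have hqt : q ^ Real.logb q t = t := Real.rpow_logb hq0 hq1.ne ht0
  refine ⟨Real.logb q t, ⟨Real.logb_pos_of_base_lt_one hq0 hq1 ht0 ht1, ?_⟩, ?_⟩
  · rw [qDigamma_eq_zero_iff hq0 hq1, hqt, ht]
  · rintro y ⟨hy, hy0⟩
    rw [qDigamma_eq_zero_iff hq0 hq1, ← ht] at hy0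
    have hyt : q ^ y = t := (strictMonoOn_qDigammaSeries hq0 hq1).injOn
      ⟨(Real.rpow_pos_of_pos hq0 y).le, Real.rpow_lt_one hq0.le hq1 hy⟩ ⟨ht0.le, ht1⟩ hy0
    rw [← hyt, Real.logb_rpow hq0 hq1.ne]
end
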